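/- arXiv:2604.25025 — 4 statements merged into one kernel-verified Lean document; each statement's English description precedes it below -/
import Mathlib

section
/- Let m ∈ ℝ, s > 0, and let c ∈ ℝ satisfy |c - m| ≤ s. For the Gaussian measure on ℝ with mean m and variance s², the measure of the interval (c, ∞) is at least 1/(4e√π). (Gaussian anti-concentration, Lemma 3 of the paper: when the estimation error |h(x,x') - h_t(x,x')| is at most one posterior standard deviation v_t·σ_t(x,x'), the Thompson sample h̃_t(x,x') exceeds the true value h(x,x') with probability at least p = 1/(4e√π).) -/
open MeasureTheory ProbabilityTheory Real

/-- To the right of its mean the Gaussian density is nonincreasing, so an interval there has mass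
at least its length times the density at its right endpoint. -/
lemma ofReal_gaussianPDFReal_mul_le_gaussianReal_Ioc {m a b : ℝ} {v : NNReal} (hv : v ≠ 0)
    (ha : m ≤ a) :
    ENNReal.ofReal (gaussianPDFReal m v b * (b - a)) ≤ gaussianReal m v (Set.Ioc a b) := by
  rw [gaussianReal_apply m hv, ENNReal.ofReal_mul (gaussianPDFReal_nonneg m v b),
    ← Real.volume_Ioc, ← setLIntegral_const]
  refine setLIntegral_mono (measurable_gaussianPDF m v) fun x hx ↦ ENNReal.ofReal_le_ofReal ?_
  simp only [gaussianPDFReal]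
  have hax : 0 ≤ x - m := by linarith [hx.1]
  have hxb : x - m ≤ b - m := by linarith [hx.2]
  gcongr

/-- **Lemma 3, Gaussian anti-concentration.** If `|c - m| ≤ s`, then
the Gaussian measure with mean `m` and variance `s²` gives mass at least
`1/(4e√π)` to the interval `(c, ∞)`. -/
theorem gaussian_anti_concentration (m s c : ℝ) (hs : 0 < s) (hc : |c - m| ≤ s) :
    ENNReal.ofReal (1 / (4 * Real.exp 1 * Real.sqrt π)) ≤
      gaussianReal m (⟨s, hs.le⟩ ^ 2) (Set.Ioi c) := by
  have hv : (⟨s, hs.le⟩ ^ 2 : NNReal) ≠ 0 :=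
    pow_ne_zero 2 (ne_of_gt (show (0 : NNReal) < ⟨s, hs.le⟩ from hs))
  have hvar : ((⟨s, hs.le⟩ ^ 2 : NNReal) : ℝ) = s ^ 2 := NNReal.coe_pow ⟨s, hs.le⟩ 2
  have hpdf : gaussianPDFReal m (⟨s, hs.le⟩ ^ 2) (m + √2 * s) * (m + √2 * s - (m + s)) =
      (1 - 1 / √2) / (Real.exp 1 * √π) := by
    have hexp : -(m + √2 * s - m) ^ 2 / (2 * s ^ 2) = -1 := by
      rw [add_sub_cancel_left, mul_pow, Real.sq_sqrt (by norm_num)]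
      field_simp
    have hsqrt : √(2 * π * s ^ 2) = √2 * √π * s := by
      rw [Real.sqrt_mul (by positivity), Real.sqrt_mul (by norm_num), Real.sqrt_sq hs.le]
    simp only [gaussianPDFReal, hvar, hexp, hsqrt, Real.exp_neg]
    field_simp
    ring
  have hsqrt2 : 1 / √2 ≤ 3 / 4 := by
    rw [div_le_iff₀ (by positivity)]
    nlinarith [Real.sq_sqrt (show (0 : ℝ) ≤ 2 by norm_num), Real.sqrt_nonneg 2]
  calc ENNReal.ofReal (1 / (4 * Real.exp 1 * √π))
      = ENNReal.ofReal (1 / 4 / (Real.exp 1 * √π)) := by rw [div_div, mul_assoc]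
    _ ≤ ENNReal.ofReal ((1 - 1 / √2) / (Real.exp 1 * √π)) := by
      gcongr
      linarith
    _ ≤ gaussianReal m (⟨s, hs.le⟩ ^ 2) (Set.Ioc (m + s) (m + √2 * s)) :=
      hpdf ▸ ofReal_gaussianPDFReal_mul_le_gaussianReal_Ioc hv (by linarith)
    _ ≤ gaussianReal m (⟨s, hs.le⟩ ^ 2) (Set.Ioi c) :=
      measure_mono fun x hx ↦ by
        have := (abs_le.mp hc).2
        exact lt_of_le_of_lt (by linarith) hx.1
end

section
/- Let C be a finite nonempty set, let f, f̃₁, f̃₂ : C → ℝ, let σ : C × C → ℝ be symmetric (σ(x,u) = σ(u,x)) and nonnegative, and let d ≥ 0. Assume: (i) for all x, u ∈ C and each i ∈ {1,2}, |(f̃ᵢ(x) - f̃ᵢ(u)) - (f(x) - f(u))| ≤ d·σ(x,u); (ii) x* ∈ C maximizes f over C; (iii) x_t ∈ C maximizes f̃₁ over C and x'_t ∈ C maximizes f̃₂ over C; (iv) there exist x̄, x̄' ∈ C with f(x*) - f(x̄) ≤ d·σ(x̄, x'_t) and f(x*) - f(x̄') ≤ d·σ(x̄', x_t). Then f(x*)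 - (f(x_t) + f(x'_t))/2 ≤ d·(σ(x̄, x'_t) + σ(x̄', x_t) + σ(x_t, x'_t)). (Deterministic core of Lemma 7: on the good event where both Thompson samples are d·σ-close to the truth on all pairs and both selected actions are argmaxes of separable samples, the per-round utility regret is bounded by the posterior uncertainties at the played pair and at the least-variance unsaturated points.) -/
/-- **deterministic core of Lemma 7.** On the good event where both
(separable) Thompson samples are `d·σ`-close to the truth on all pairs, the
selected actions are argmaxes of the respective samples, and there exist
unsaturated points `x̄, x̄'`, the per-round utility regret of the played pair is
bounded by the posterior uncertainties at the played pair and at the unsaturated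
points. -/
theorem per_round_utility_regret_bound
    {C : Type*} [Fintype C] [Nonempty C]
    (f ftil₁ ftil₂ : C → ℝ)
    (σ : C → C → ℝ) (hσsym : ∀ x u, σ x u = σ u x) (hσnonneg : ∀ x u, 0 ≤ σ x u)
    (d : ℝ) (hd : 0 ≤ d)
    (hconc₁ : ∀ x u, |(ftil₁ x - ftil₁ u) - (f x - f u)| ≤ d * σ x u)
    (hconc₂ : ∀ x u, |(ftil₂ x - ftil₂ u) - (f x - f u)| ≤ d * σ x u)
    (xstar : C) (hstar : ∀ x, f x ≤ f xstar)
    (xt : C) (hxt : ∀ x, ftil₁ x ≤ ftil₁ xt)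
    (xt' : C) (hxt' : ∀ x, ftil₂ x ≤ ftil₂ xt')
    (xbar xbar' : C)
    (hxbar : f xstar - f xbar ≤ d * σ xbar xt')
    (hxbar' : f xstar - f xbar' ≤ d * σ xbar' xt) :
    f xstar - (f xt + f xt') / 2 ≤ d * (σ xbar xt' + σ xbar' xt + σ xt xt') := by
  have h₁ := neg_le_of_abs_le (hconc₁ xbar' xt)
  have h₂ := neg_le_of_abs_le (hconc₂ xbar xt')
  have hσ := mul_nonneg hd (hσnonneg xt xt')
  linarith [hxt xbar', hxt' xbar]
end

section
/- Let C be a finite nonempty set, let f, f̃₁, f̃₂ : C → ℝ, let σ : C × C → ℝ be symmetric (σ(x,u) = σ(u,x)) and nonnegative, let d ≥ 0, and let μ : ℝ → ℝ be L-Lipschitz with μ(0) = 1/2 (L ≥ 0). Assume: (i) for all x, u ∈ C and each i ∈ {1,2}, |(f̃ᵢ(x) - f̃ᵢ(u)) - (f(x) - f(u))| ≤ d·σ(x,u); (ii) x* ∈ C maximizes f over C; (iii) x_t ∈ C maximizes f̃₁ over C and x'_t ∈ C maximizes f̃₂ over C; (iv) there exist x̄, x̄' ∈ C with f(x*) - f(x̄)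 ≤ d·σ(x̄, x'_t) and f(x*) - f(x̄') ≤ d·σ(x̄', x_t). Then the instantaneous dueling regret satisfies (μ(f(x*) - f(x_t)) + μ(f(x*) - f(x'_t)) - 1)/2 ≤ L·d·(σ(x̄, x'_t) + σ(x̄', x_t) + σ(x_t, x'_t)). (Lemma 7 of the paper, restricted to the finite candidate set: on the good event, the instantaneous regret is bounded by (L_μ d_t/4)·(2σ(x̄,x'_t) + 2σ(x̄',x_t) + 2σ(x_t,x'_t)).) -/
/-- **Lemma 7 on the finite candidate set.** Under the good event of
Statement 13 and with an `L`-Lipschitz link `μ` satisfying `μ(0) = 1/2`, the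
instantaneous dueling regret is bounded by
`L·d·(σ(x̄,x'_t) + σ(x̄',x_t) + σ(x_t,x'_t))`. -/
theorem instantaneous_dueling_regret_bound
    {C : Type*} [Fintype C] [Nonempty C]
    (f ftil₁ ftil₂ : C → ℝ)
    (σ : C → C → ℝ) (hσsym : ∀ x u, σ x u = σ u x) (hσnonneg : ∀ x u, 0 ≤ σ x u)
    (d : ℝ) (hd : 0 ≤ d)
    (μ : ℝ → ℝ) (L : ℝ) (hL : 0 ≤ L)
    (hlip : ∀ u v : ℝ, |μ u - μ v| ≤ L * |u - v|)
    (hhalf : μ 0 = 1 / 2)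
    (hconc₁ : ∀ x u, |(ftil₁ x - ftil₁ u) - (f x - f u)| ≤ d * σ x u)
    (hconc₂ : ∀ x u, |(ftil₂ x - ftil₂ u) - (f x - f u)| ≤ d * σ x u)
    (xstar : C) (hstar : ∀ x, f x ≤ f xstar)
    (xt : C) (hxt : ∀ x, ftil₁ x ≤ ftil₁ xt)
    (xt' : C) (hxt' : ∀ x, ftil₂ x ≤ ftil₂ xt')
    (xbar xbar' : C)
    (hxbar : f xstar - f xbar ≤ d * σ xbar xt')
    (hxbar' : f xstar - f xbar' ≤ d * σ xbar' xt) :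
    (μ (f xstar - f xt) + μ (f xstar - f xt') - 1) / 2 ≤
      L * d * (σ xbar xt' + σ xbar' xt + σ xt xt') := by
  have gap₁ : f xstar - f xt ≤ 2 * (d * σ xbar' xt) := by
    linarith [(abs_le.mp (hconc₁ xbar' xt)).1, hxt xbar']
  have gap₂ : f xstar - f xt' ≤ 2 * (d * σ xbar xt') := by
    linarith [(abs_le.mp (hconc₂ xbar xt')).1, hxt' xbar]
  have link_le : ∀ {u b : ℝ}, 0 ≤ u → u ≤ b → μ u - 1 / 2 ≤ L * b := by
    intro u b hu hub
    have h := (le_abs_self _).trans (hlip u 0)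
    rw [hhalf, sub_zero, abs_of_nonneg hu] at h
    exact h.trans (mul_le_mul_of_nonneg_left hub hL)
  have h₁ := link_le (sub_nonneg.mpr (hstar xt)) gap₁
  have h₂ := link_le (sub_nonneg.mpr (hstar xt')) gap₂
  have h₃ : 0 ≤ L * d * σ xt xt' := mul_nonneg (mul_nonneg hL hd) (hσnonneg xt xt')
  linarith
end

section
/- Let Z be a set and K : Z × Z → ℝ a symmetric positive semidefinite kernel with K(z,z) ≤ 4 for all z ∈ Z. Let c > 0, T ≥ 1, and z₁,…,z_T ∈ Z. For 0 ≤ t ≤ T define the t × t Gram matrix K_t with entries (K_t)_{ij} = K(zᵢ,zⱼ) for i,j ≤ t, and the posterior variance σ_t²(z) = K(z,z) - v_t(z)ᵀ (K_t + c·I)⁻¹ v_t(z), where v_t(z) ∈ ℝᵗ has entries v_t(z)ᵢ = K(z,zᵢ) (so σ₀²(z) = K(z,z)). Suppose Γ ∈ ℝ satisfies Γ ≥ (1/2)·log det(I + c⁻¹·K'_T) for every choice of T points z'₁,…,z'_T ∈ Z with Gram matrix K'_T. Then Σ_{t=1}^{T} σ_{t-1}(z_t) ≤ √( 8·T·Γ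 / log(1 + 4/c) ), where σ_{t-1}(z_t) denotes the nonnegative square root of σ_{t-1}²(z_t). (Lemma 9 of the paper with c = λκ and Γ = Γ(T) the maximum information gain: the sum of posterior standard deviations at the played pairs is at most √(8TΓ(T)/log(1 + 4(λκ)⁻¹)).) -/
/-- The regularised Gram matrix `K_t + c • 1` of the first `t` points of a sequence. -/
abbrev regGram {Z : Type*} (K : Z → Z → ℝ) (c : ℝ) (z : ℕ → Z) (t : ℕ) :
    Matrix (Fin t) (Fin t) ℝ :=
  Matrix.of (fun i j : Fin t => K (z (i : ℕ)) (z (j : ℕ))) + c • 1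

open Matrix in
/-- The posterior variance at the point `z t` given the points `z 0, …, z (t - 1)`. -/
noncomputable abbrev posteriorVar {Z : Type*} (K : Z → Z → ℝ) (c : ℝ) (z : ℕ → Z) (t : ℕ) : ℝ :=
  K (z t) (z t) - (fun i : Fin t => K (z t) (z (i : ℕ))) ⬝ᵥ
    ((regGram K c z t)⁻¹ *ᵥ fun i : Fin t => K (z t) (z (i : ℕ)))

section PosteriorVariance

variable {Z : Type*} {K : Z → Z → ℝ} {c : ℝ}

open Matrix in
theorem posSemidef_gram (hsym : ∀ x u, K x u = K u x)
    (hpsd : ∀ (n : ℕ) (x : Fin n → Z) (a : Fin n → ℝ),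
      0 ≤ ∑ i, ∑ j, a i * a j * K (x i) (x j)) (z : ℕ → Z) (t : ℕ) :
    (Matrix.of (fun i j : Fin t => K (z (i : ℕ)) (z (j : ℕ)))).PosSemidef := by
  refine PosSemidef.of_dotProduct_mulVec_nonneg (by ext i j; simp [hsym (z j)]) fun a => ?_
  refine (hpsd t (fun i => z i) a).trans_eq ?_
  simp only [dotProduct, mulVec, Finset.mul_sum, of_apply, star_trivial]
  exact Finset.sum_congr rfl fun i _ => Finset.sum_congr rfl fun j _ => by ring

open Matrix in
theorem posDef_regGram (hsym : ∀ x u, K x u = K u x)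
    (hpsd : ∀ (n : ℕ) (x : Fin n → Z) (a : Fin n → ℝ),
      0 ≤ ∑ i, ∑ j, a i * a j * K (x i) (x j)) (hc : 0 < c) (z : ℕ → Z) (t : ℕ) :
    (regGram K c z t).PosDef :=
  PosDef.posSemidef_add (posSemidef_gram hsym hpsd z t) (PosDef.one.smul hc)

open Matrix in
theorem posteriorVar_le (hsym : ∀ x u, K x u = K u x)
    (hpsd : ∀ (n : ℕ) (x : Fin n → Z) (a : Fin n → ℝ),
      0 ≤ ∑ i, ∑ j, a i * a j * K (x i) (x j)) (hc : 0 < c) (z : ℕ → Z) (t : ℕ) :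
    posteriorVar K c z t ≤ K (z t) (z t) := by
  have h := (posDef_regGram hsym hpsd hc z t).inv.posSemidef.dotProduct_mulVec_nonneg
    (fun i : Fin t => K (z t) (z (i : ℕ)))
  rw [star_trivial] at h
  exact sub_le_self _ h

open Matrix in
theorem posteriorVar_nonneg (hsym : ∀ x u, K x u = K u x)
    (hpsd : ∀ (n : ℕ) (x : Fin n → Z) (a : Fin n → ℝ),
      0 ≤ ∑ i, ∑ j, a i * a j * K (x i) (x j)) (hc : 0 < c) (z : ℕ → Z) (t : ℕ) :
    0 ≤ posteriorVar K c z t := by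
  have hdet : IsUnit (regGram K c z t).det :=
    (posDef_regGram hsym hpsd hc z t).det_pos.ne'.isUnit
  unfold posteriorVar
  set v : Fin t → ℝ := fun i => K (z t) (z (i : ℕ)) with hv
  set w : Fin t → ℝ := (regGram K c z t)⁻¹ *ᵥ v with hw
  have hGw : regGram K c z t *ᵥ w = v := by
    rw [hw, mulVec_mulVec, mul_nonsing_inv _ hdet, one_mulVec]
  have hquad : w ⬝ᵥ (Matrix.of (fun i j : Fin t => K (z (i : ℕ)) (z (j : ℕ))) *ᵥ w) +
      c * (w ⬝ᵥ w) = v ⬝ᵥ w := by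
    rw [dotProduct_comm v w, ← hGw, regGram, add_mulVec, smul_mulVec, one_mulVec,
      dotProduct_add, dotProduct_smul, smul_eq_mul]
  have hww : 0 ≤ w ⬝ᵥ w := Finset.sum_nonneg fun i _ => mul_self_nonneg _
  have h := (posSemidef_gram hsym hpsd z (t + 1)).dotProduct_mulVec_nonneg
    (Fin.snoc (α := fun _ => ℝ) (-w) 1)
  have hexp : star (Fin.snoc (α := fun _ => ℝ) (-w) 1) ⬝ᵥ
      (Matrix.of (fun i j : Fin (t + 1) => K (z (i : ℕ)) (z (j : ℕ))) *ᵥ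
        Fin.snoc (α := fun _ => ℝ) (-w) 1) =
      w ⬝ᵥ (Matrix.of (fun i j : Fin t => K (z (i : ℕ)) (z (j : ℕ))) *ᵥ w)
        - 2 * (v ⬝ᵥ w) + K (z t) (z t) := by
    simp only [dotProduct, mulVec, star_trivial, Fin.sum_univ_castSucc, Fin.snoc_castSucc,
      Fin.snoc_last, of_apply, Fin.val_castSucc, Fin.val_last, Pi.neg_apply, hv,
      fun i : Fin t => hsym (z i) (z t), mul_neg, neg_mul, mul_add, Finset.sum_add_distrib,
      Finset.sum_neg_distrib, mul_one, one_mul,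
      fun i : Fin t => mul_comm (w i) (K (z t) (z i))]
    ring
  rw [hexp] at h
  nlinarith [mul_nonneg hc.le hww]

open Matrix in
theorem det_regGram_succ (hsym : ∀ x u, K x u = K u x)
    (hpsd : ∀ (n : ℕ) (x : Fin n → Z) (a : Fin n → ℝ),
      0 ≤ ∑ i, ∑ j, a i * a j * K (x i) (x j)) (hc : 0 < c) (z : ℕ → Z) (t : ℕ) :
    (regGram K c z (t + 1)).det = (regGram K c z t).det * (c + posteriorVar K c z t) := by
  have hdet : IsUnit (regGram K c z t).det :=
    (posDef_regGram hsym hpsd hc z t).det_pos.ne'.isUnit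
  let _ := invertibleOfIsUnitDet _ hdet
  have hblocks : (regGram K c z (t + 1)).submatrix finSumFinEquiv finSumFinEquiv =
      fromBlocks (regGram K c z t) (replicateCol (Fin 1) fun i : Fin t => K (z t) (z i))
        (replicateRow (Fin 1) fun i : Fin t => K (z t) (z i))
        (Matrix.of fun _ _ : Fin 1 => c + K (z t) (z t)) := by
    ext i j
    rcases i with i | i <;> rcases j with j | j
    · simp [regGram, one_apply]
    · have : Fin.castAdd 1 i ≠ Fin.natAdd t j := by
        simp [Fin.ext_iff]; omega
      simp [regGram, one_apply, hsym (z i), this]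
    · have : Fin.natAdd t i ≠ Fin.castAdd 1 j := by
        simp [Fin.ext_iff]; omega
      simp [regGram, one_apply, this]
    · simp [regGram, one_apply, Subsingleton.elim i j, add_comm]
  rw [← det_submatrix_equiv_self finSumFinEquiv, hblocks, det_fromBlocks₁₁, invOf_eq_nonsing_inv,
    det_fin_one]
  congr 1
  rw [Matrix.mul_assoc, ← replicateCol_mulVec, Matrix.sub_apply, replicateRow_mul_replicateCol_apply,
    of_apply, add_sub_assoc]

open Matrix in
theorem det_one_add_smul_gram (hsym : ∀ x u, K x u = K u x)
    (hpsd : ∀ (n : ℕ) (x : Fin n → Z) (a : Fin n → ℝ),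
      0 ≤ ∑ i, ∑ j, a i * a j * K (x i) (x j)) (hc : 0 < c) (z : ℕ → Z) (t : ℕ) :
    (1 + c⁻¹ • Matrix.of (fun i j : Fin t => K (z (i : ℕ)) (z (j : ℕ)))).det =
      ∏ s ∈ Finset.range t, (1 + posteriorVar K c z s / c) := by
  have hscale : 1 + c⁻¹ • Matrix.of (fun i j : Fin t => K (z (i : ℕ)) (z (j : ℕ))) =
      c⁻¹ • regGram K c z t := by
    rw [regGram, smul_add, inv_smul_smul₀ hc.ne', add_comm]
  rw [hscale, det_smul, Fintype.card_fin]
  clear hscale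
  induction t with
  | zero => simp
  | succ t ih =>
    have hfactor : 1 + posteriorVar K c z t / c = c⁻¹ * (c + posteriorVar K c z t) := by
      rw [mul_add, inv_mul_cancel₀ hc.ne', div_eq_inv_mul]
    rw [Finset.prod_range_succ, ← ih, det_regGram_succ hsym hpsd hc, hfactor]
    ring

end PosteriorVariance

/-- Concavity of `log` on `[1, 1 + b]`: the chord lies below the graph. -/
theorem mul_log_one_add_le {b s : ℝ} (hb : 0 < b) (hs : 0 ≤ s) (hsb : s ≤ b) :
    s * Real.log (1 + b) ≤ b * Real.log (1 + s) := by
  have h := strictConcaveOn_log_Ioi.concaveOn.2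
    (Set.mem_Ioi.2 (by linarith : 0 < 1 + b)) (Set.mem_Ioi.2 one_pos)
    (div_nonneg hs hb.le) (sub_nonneg.2 ((div_le_one hb).2 hsb)) (by ring)
  have harg : s / b * (1 + b) + (1 - s / b) * 1 = 1 + s := by field_simp; ring
  simp only [smul_eq_mul, Real.log_one, mul_zero, add_zero] at h
  rw [harg, div_mul_eq_mul_div, div_le_iff₀ hb] at h
  linarith


open Matrix in
/-- **Lemma 9.** For a symmetric PSD kernel bounded by 4 on the
diagonal, the sum of the sequential posterior standard deviations at the queried
points is at most `√(8·T·Γ / log(1 + 4/c))`, whenever `Γ` dominates the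
information gain `(1/2)·log det(I + c⁻¹·K'_T)` of every `T`-point Gram matrix.
Here the points are `z 0, …, z (T-1)` and the posterior variance before round `t`
uses the Gram matrix of the first `t` points. -/
theorem sum_posterior_stds_le_sqrt_info_gain
    {Z : Type*} (K : Z → Z → ℝ)
    (hsym : ∀ x u, K x u = K u x)
    (hpsd : ∀ (n : ℕ) (x : Fin n → Z) (a : Fin n → ℝ),
      0 ≤ ∑ i, ∑ j, a i * a j * K (x i) (x j))
    (hbound : ∀ z, K z z ≤ 4)
    (c : ℝ) (hc : 0 < c)
    (T : ℕ) (hT : 1 ≤ T)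
    (z : ℕ → Z)
    (Γ : ℝ)
    (hΓ : ∀ w : Fin T → Z,
      (1 / 2) * Real.log
          (Matrix.det (1 + c⁻¹ • Matrix.of fun i j => K (w i) (w j))) ≤ Γ) :
    ∑ t ∈ Finset.range T,
        Real.sqrt (K (z t) (z t) -
          (fun i : Fin t => K (z t) (z (i : ℕ))) ⬝ᵥ
            ((Matrix.of (fun i j : Fin t => K (z (i : ℕ)) (z (j : ℕ))) + c • 1)⁻¹ *ᵥ
              fun i : Fin t => K (z t) (z (i : ℕ))))
      ≤ Real.sqrt (8 * T * Γ / Real.log (1 + 4 / c)) := by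
  have hL : 0 < Real.log (1 + 4 / c) := Real.log_pos (lt_add_of_pos_right 1 (by positivity))
  have hnn := posteriorVar_nonneg hsym hpsd hc z
  have hgain : ∑ t ∈ Finset.range T, Real.log (1 + posteriorVar K c z t / c) ≤ 2 * Γ := by
    have h := hΓ fun i => z i
    rw [det_one_add_smul_gram hsym hpsd hc, Real.log_prod] at h
    · linarith
    · intro t _
      have := div_nonneg (hnn t) hc.le
      positivity
  have hterm (t : ℕ) : posteriorVar K c z t * Real.log (1 + 4 / c) ≤
      4 * Real.log (1 + posteriorVar K c z t / c) := by
    have h := mul_log_one_add_le (b := 4 / c) (by positivity) (div_nonneg (hnn t) hc.le)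
      (by gcongr; exact (posteriorVar_le hsym hpsd hc z t).trans (hbound _))
    rw [div_mul_eq_mul_div, div_mul_eq_mul_div] at h
    exact (div_le_div_iff_of_pos_right hc).1 h
  have hvar : ∑ t ∈ Finset.range T, posteriorVar K c z t ≤ 8 * Γ / Real.log (1 + 4 / c) := by
    rw [le_div_iff₀ hL, Finset.sum_mul]
    calc _ ≤ ∑ t ∈ Finset.range T, 4 * Real.log (1 + posteriorVar K c z t / c) :=
          Finset.sum_le_sum fun t _ => hterm t
      _ ≤ 8 * Γ := by rw [← Finset.mul_sum]; linarith
  refine Real.le_sqrt_of_sq_le ?_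
  calc (∑ t ∈ Finset.range T, Real.sqrt (posteriorVar K c z t)) ^ 2
      ≤ T * ∑ t ∈ Finset.range T, Real.sqrt (posteriorVar K c z t) ^ 2 := by
        simpa using sq_sum_le_card_mul_sum_sq (s := Finset.range T)
          (f := fun t => Real.sqrt (posteriorVar K c z t))
    _ = T * ∑ t ∈ Finset.range T, posteriorVar K c z t := by
        simp only [Real.sq_sqrt (hnn _)]
    _ ≤ T * (8 * Γ / Real.log (1 + 4 / c)) := by gcongr
    _ = 8 * T * Γ / Real.log (1 + 4 / c) := by ring
end
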